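/- A state-finite automaton without outputs is a retractable automaton if and only if it is a dilation of a semi-connected retractable automaton (i.e., it has a semi-connected retractable subautomaton of which it is a dilation). -/

import Mathlib

/-! Basic notions for state-finite automata without outputs, following M. Fuzesdi,
"Boolean-type retractable state-finite automata without outputs". -/

variable {A X : Type*}

/-- The transition function extended to words: `DeltaStar d a p = δ(a, p)`. -/
def DeltaStar (d : A → X → A) (a : A) (p : List X) : A := p.foldl d a

/-- `B` is (the state set of) a subautomaton of the automaton `(A, X, d)`. -/
def IsSubaut (d : A → X → A) (B : Set A) : Prop :=
  B.Nonempty ∧ ∀ b ∈ B, ∀ x, d b x ∈ B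

/-- `f` (restricted to `B`) is a retract homomorphism of the automaton `B`
onto its subautomaton `C`: it commutes with the transitions on `B`, maps `B` into `C`,
and leaves the elements of `C` fixed (hence is onto `C` whenever `C ⊆ B`). -/
def IsRetractHomOn (d : A → X → A) (B C : Set A) (f : A → A) : Prop :=
  (∀ a ∈ B, ∀ x, f (d a x) = d (f a) x) ∧ (∀ a ∈ B, f a ∈ C) ∧ (∀ c ∈ C, f c = c)

/-- The automaton `B` is retractable: every subautomaton of `B` is a retract
subautomaton of `B`. -/
def RetractableOn (d : A → X → A) (B : Set A) : Prop :=
  ∀ C, C ⊆ B → IsSubaut d C → ∃ f : A → A, IsRetractHomOn d B C f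

/-- The automaton `B` is a Boolean-type retractable automaton: it is retractable and there
is a family of retract homomorphisms `Λ C` of `B` onto `C`, one for each subautomaton `C`
of `B`, such that `C₁ ⊆ C₂` implies `Ker (Λ C₂) ⊆ Ker (Λ C₁)` (kernels taken on `B`). -/
def BooleanTypeOn (d : A → X → A) (B : Set A) : Prop :=
  RetractableOn d B ∧
  ∃ Λ : Set A → (A → A),
    (∀ C, C ⊆ B → IsSubaut d C → IsRetractHomOn d B C (Λ C)) ∧
    (∀ C₁ C₂, C₁ ⊆ C₂ → C₂ ⊆ B → IsSubaut d C₁ → IsSubaut d C₂ →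
      ∀ a ∈ B, ∀ b ∈ B, Λ C₂ a = Λ C₂ b → Λ C₁ a = Λ C₁ b)

/-- The Rees congruence defined by `B`. -/
def ReesRel (B : Set A) : A → A → Prop := fun a b => a = b ∨ (a ∈ B ∧ b ∈ B)

/-- The kernel of a map, as a relation. -/
def KerRel (f : A → A) : A → A → Prop := fun a b => f a = f b

/-- `r` is a congruence of the automaton `(A, X, d)`. -/
def IsCong (d : A → X → A) (r : A → A → Prop) : Prop :=
  Equivalence r ∧ ∀ a b, r a b → ∀ x, r (d a x) (d b x)

/-- `K` is the kernel of the automaton `B`: a subautomaton of `B` contained in every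
subautomaton of `B`. -/
def IsKernelOf (d : A → X → A) (B K : Set A) : Prop :=
  IsSubaut d K ∧ K ⊆ B ∧ ∀ C, C ⊆ B → IsSubaut d C → K ⊆ C

/-- The subautomata `S` and `T` (with the common transition function `d`) are isomorphic. -/
def AutIsoOn (d : A → X → A) (S T : Set A) : Prop :=
  ∃ f : A → A, Set.BijOn f S T ∧ ∀ a ∈ S, ∀ x, f (d a x) = d (f a) x

/-- `c` is a trap of the automaton with transition function `d`. -/
def IsTrapT (d : A → X → A) (c : A) : Prop := ∀ x, d c x = c

/-- The automaton with transition function `d` is strongly connected. -/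
def StronglyConnT (d : A → X → A) : Prop :=
  ∀ a b : A, ∃ p : List X, p ≠ [] ∧ DeltaStar d a p = b

/-- The automaton with transition function `d` is strongly trap connected. -/
def StronglyTrapConnT (d : A → X → A) : Prop :=
  ∃ a₀ : A, IsTrapT d a₀ ∧ (∀ c, IsTrapT d c → c = a₀) ∧
    ∀ a, a ≠ a₀ → ∀ b, ∃ p : List X, p ≠ [] ∧ DeltaStar d a p = b

/-- `R(a)`: the subautomaton generated by `a`. -/
def Rset (d : A → X → A) (a : A) : Set A := {b | ∃ p : List X, DeltaStar d a p = b}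

lemma Rset_closed (d : A → X → A) (a : A) {b : A} (hb : b ∈ Rset d a) (x : X) :
    d b x ∈ Rset d a := by
  obtain ⟨p, hp⟩ := hb
  refine ⟨p ++ [x], ?_⟩
  simp only [DeltaStar, List.foldl_append, List.foldl_cons, List.foldl_nil]
  rw [show List.foldl d a p = b from hp]

lemma Rset_mono (d : A → X → A) {a b : A} (h : b ∈ Rset d a) : Rset d b ⊆ Rset d a := by
  obtain ⟨q, hq⟩ := h
  rintro c ⟨p, hp⟩
  refine ⟨q ++ p, ?_⟩
  simp only [DeltaStar, List.foldl_append] at *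
  rw [hq, hp]

/-- `R_a`: the set of states generating the same subautomaton as `a`. -/
def Rcls (d : A → X → A) (a : A) : Set A := {b | Rset d b = Rset d a}

/-- `R[a] = R(a) \ R_a`. -/
def Rbr (d : A → X → A) (a : A) : Set A := Rset d a \ Rcls d a

lemma Rbr_closed (d : A → X → A) (a : A) {b : A} (hb : b ∈ Rbr d a) (x : X) :
    d b x ∈ Rbr d a := by
  refine ⟨Rset_closed d a hb.1 x, fun hmem => hb.2 ?_⟩
  have h1 : Rset d b ⊆ Rset d a := Rset_mono d hb.1
  have hx : d b x ∈ Rset d b := ⟨[x], rfl⟩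
  have h2 : Rset d a ⊆ Rset d b := by
    have := Rset_mono d hx
    rw [show Rset d (d b x) = Rset d a from hmem] at this
    exact this
  exact Set.Subset.antisymm h1 h2

/-- The Rees setoid on `R(a)` collapsing the subautomaton `R[a]` to a point. -/
def PFSetoid (d : A → X → A) (a : A) : Setoid ↥(Rset d a) where
  r s t := s = t ∨ (s.1 ∈ Rbr d a ∧ t.1 ∈ Rbr d a)
  iseqv := by
    refine ⟨fun s => Or.inl rfl, ?_, ?_⟩
    · rintro s t (rfl | ⟨h1, h2⟩)
      · exact Or.inl rfl
      · exact Or.inr ⟨h2, h1⟩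
    · rintro s t u (rfl | ⟨h1, h2⟩) (rfl | ⟨h3, h4⟩)
      · exact Or.inl rfl
      · exact Or.inr ⟨h3, h4⟩
      · exact Or.inr ⟨h1, h2⟩
      · exact Or.inr ⟨h1, h4⟩

/-- The state set of the principal factor `R{a} = R(a)/ρ_{R[a]}`. -/
def PFC (d : A → X → A) (a : A) : Type _ := Quotient (PFSetoid d a)

/-- The transition function of the principal factor `R{a}`. -/
def pfd (d : A → X → A) (a : A) : PFC d a → X → PFC d a := fun q x =>
  Quotient.liftOn q
    (fun s => (Quotient.mk (PFSetoid d a) ⟨d s.1 x, Rset_closed d a s.2 x⟩ : PFC d a))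
    (fun s t hst => Quotient.sound (by
      rcases hst with h | ⟨h1, h2⟩
      · exact Or.inl (by rw [h])
      · exact Or.inr ⟨Rbr_closed d a h1 x, Rbr_closed d a h2 x⟩))

/-- The automaton with transition function `d` is semi-connected: each of its
principal factors is strongly connected or strongly trap connected. -/
def SemiConnT (d : A → X → A) : Prop :=
  ∀ a : A, StronglyConnT (pfd d a) ∨ StronglyTrapConnT (pfd d a)

/-- The restriction of the transition function to a subautomaton. -/
def restrictMap (d : A → X → A) (B : Set A) (h : ∀ b ∈ B, ∀ x, d b x ∈ B) : B → X → B :=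
  fun b x => ⟨d b.1 x, h b.1 b.2 x⟩

open Classical in
/-- `A⁰`: the state set with the trap removed, in case the automaton is non-trivial
and has a unique trap; the whole state set otherwise. -/
noncomputable def ZeroPart (d : A → X → A) : Set A :=
  if Nontrivial A ∧ (∃! c : A, IsTrapT d c) then {c | ¬ IsTrapT d c} else Set.univ

lemma deltaStar_append (d : A → X → A) (a : A) (p q : List X) :
    DeltaStar d a (p ++ q) = DeltaStar d (DeltaStar d a p) q :=
  List.foldl_append

lemma self_mem_Rset (d : A → X → A) (a : A) : a ∈ Rset d a := ⟨[], rfl⟩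

lemma Rset_isSubaut (d : A → X → A) (a : A) : IsSubaut d (Rset d a) :=
  ⟨⟨a, self_mem_Rset d a⟩, fun _ hb x => Rset_closed d a hb x⟩

/-- `a` is recurrent: some nonempty word leads from `a` back to `a`. -/
def IsRecurrent (d : A → X → A) (a : A) : Prop :=
  ∃ p : List X, p ≠ [] ∧ DeltaStar d a p = a

lemma IsRecurrent.exists_ne_nil_deltaStar_eq {d : A → X → A} {a b : A} (ha : IsRecurrent d a)
    (hb : b ∈ Rset d a) : ∃ p : List X, p ≠ [] ∧ DeltaStar d a p = b := by
  obtain ⟨q, hq, hqa⟩ := ha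
  obtain ⟨p, hp⟩ := hb
  exact ⟨q ++ p, by simp [hq], by rw [deltaStar_append, hqa, hp]⟩

lemma deltaStar_pfd_mk (d : A → X → A) (a : A) (p : List X) (s t : Rset d a)
    (h : DeltaStar d s.1 p = t.1) :
    DeltaStar (pfd d a) (Quotient.mk (PFSetoid d a) s) p = Quotient.mk (PFSetoid d a) t := by
  induction p generalizing s with
  | nil => exact congrArg _ (Subtype.ext h)
  | cons x p ih => exact ih ⟨d s.1 x, Rset_closed d a s.2 x⟩ h

lemma deltaStar_eq_of_isTrapT {d : A → X → A} {c : A} (hc : IsTrapT d c) (p : List X) :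
    DeltaStar d c p = c := by
  induction p with
  | nil => rfl
  | cons x p ih => rw [← List.singleton_append, deltaStar_append,
      show DeltaStar d c [x] = c from hc x, ih]

/-- An automaton all of whose states are recurrent is semi-connected. -/
lemma semiConnT_of_isRecurrent {d : A → X → A} (h : ∀ a, IsRecurrent d a) : SemiConnT d := by
  intro a
  have reach : ∀ s t : Rset d a, s.1 ∈ Rcls d a → ∃ p : List X, p ≠ [] ∧
      DeltaStar (pfd d a) (Quotient.mk (PFSetoid d a) s) p = Quotient.mk (PFSetoid d a) t := by
    intro s t hs
    have ht : t.1 ∈ Rset d s.1 := by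
      rw [show Rset d s.1 = Rset d a from hs]
      exact t.2
    obtain ⟨p, hp, hpt⟩ := (h s.1).exists_ne_nil_deltaStar_eq ht
    exact ⟨p, hp, deltaStar_pfd_mk d a p s t hpt⟩
  rcases (Rbr d a).eq_empty_or_nonempty with he | ⟨z, hz⟩
  · left
    intro q r
    induction q using Quotient.inductionOn with | _ s
    induction r using Quotient.inductionOn with | _ t
    refine reach s t (by_contra fun hs => ?_)
    have : s.1 ∈ Rbr d a := ⟨s.2, hs⟩
    simp [he] at this
  · right
    let z₀ : PFC d a := Quotient.mk (PFSetoid d a) ⟨z, hz.1⟩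
    have hreach : ∀ q, q ≠ z₀ → ∀ r, ∃ p : List X, p ≠ [] ∧ DeltaStar (pfd d a) q p = r := by
      intro q hq r
      induction q using Quotient.inductionOn with | _ s
      induction r using Quotient.inductionOn with | _ t
      exact reach s t (by_contra fun hs => hq (Quotient.sound (Or.inr ⟨⟨s.2, hs⟩, hz⟩)))
    refine ⟨z₀, fun x => Quotient.sound (Or.inr ⟨Rbr_closed d a hz x, hz⟩), ?_, hreach⟩
    intro c hc
    by_contra hne
    obtain ⟨p, -, hp⟩ := hreach c hne z₀
    exact hne ((deltaStar_eq_of_isTrapT hc p).symm.trans hp)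

lemma coe_deltaStar_restrictMap (d : A → X → A) (B : Set A) (h : ∀ b ∈ B, ∀ x, d b x ∈ B)
    (b : B) (p : List X) : (DeltaStar (restrictMap d B h) b p).1 = DeltaStar d b p := by
  induction p generalizing b with
  | nil => rfl
  | cons x p ih => exact ih (restrictMap d B h b x)

lemma RetractableOn.isRecurrent_apply {d : A → X → A} (h : RetractableOn d Set.univ)
    (a : A) (x : X) : IsRecurrent d (d a x) := by
  obtain ⟨f, hf, hmem, hfix⟩ := h _ (Set.subset_univ _) (Rset_isSubaut d (d a x))
  obtain ⟨p, hp⟩ := hmem a trivial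
  refine ⟨p ++ [x], by simp, ?_⟩
  rw [deltaStar_append, hp]
  exact (hf a trivial x).symm.trans (hfix _ (self_mem_Rset d _))

lemma RetractableOn.mono {d : A → X → A} {B B' : Set A} (h : RetractableOn d B')
    (hBB' : B ⊆ B') : RetractableOn d B := by
  intro C hC hsub
  obtain ⟨f, hf, hmem, hfix⟩ := h C (hC.trans hBB') hsub
  exact ⟨f, fun a ha => hf a (hBB' ha), fun a ha => hmem a (hBB' ha), hfix⟩

/-- A dilation of a retractable automaton is retractable. -/
lemma RetractableOn.of_dilation [Nonempty X] {d : A → X → A} {B : Set A} (hB : IsSubaut d B)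
    (hret : RetractableOn d B) {φ : A → A} (hφB : ∀ a, φ a ∈ B) (hφfix : ∀ b ∈ B, φ b = b)
    (hφ : ∀ a x, d a x = d (φ a) x) : RetractableOn d Set.univ := by
  classical
  intro C _ hC
  have hdB : ∀ a x, d a x ∈ B := fun a x => hφ a x ▸ hB.2 _ (hφB a) x
  obtain ⟨c, hc⟩ := hC.1
  obtain ⟨x₀⟩ := ‹Nonempty X›
  obtain ⟨g, hg, hgmem, hgfix⟩ := hret (C ∩ B) Set.inter_subset_right
    ⟨⟨d c x₀, hC.2 c hc x₀, hdB c x₀⟩, fun b hb x => ⟨hC.2 b hb.1 x, hB.2 b hb.2 x⟩⟩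
  refine ⟨fun a => if a ∈ C then a else g (φ a), ?_, ?_, ?_⟩
  · intro a _ x
    by_cases ha : a ∈ C
    · simp [ha, hC.2 a ha x]
    · have key : g (d a x) = d (g (φ a)) x := by rw [hφ a x, hg _ (hφB a)]
      by_cases hax : d a x ∈ C
      · simp only [ha, hax, if_true, if_false]
        rw [← key, hgfix _ ⟨hax, hdB a x⟩]
      · simp only [ha, hax, if_false]
        rw [hφfix _ (hdB a x), key]
  · intro a _
    by_cases ha : a ∈ C
    · simp [ha]
    · simpa [ha] using (hgmem _ (hφB a)).1
  · intro a ha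
    simp [ha]

/-- A state-finite automaton is retractable iff it is a dilation of a
semi-connected retractable automaton, i.e. it has a semi-connected retractable
subautomaton of which it is a dilation. -/
theorem retractable_iff_dilation_of_semiconnected [Finite A] [Nonempty A] [Nonempty X]
    (δ : A → X → A) :
    RetractableOn δ Set.univ ↔
      ∃ (B : Set A) (hB : IsSubaut δ B),
        (∃ φ : A → A, (∀ a, φ a ∈ B) ∧ (∀ b ∈ B, φ b = b) ∧ ∀ a x, δ a x = δ (φ a) x) ∧
        RetractableOn δ B ∧ SemiConnT (restrictMap δ B hB.2) := by
  constructor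
  · intro h
    have hB : IsSubaut δ {a | IsRecurrent δ a} :=
      ⟨⟨_, h.isRecurrent_apply (Classical.arbitrary A) (Classical.arbitrary X)⟩,
        fun b _ x => h.isRecurrent_apply b x⟩
    obtain ⟨φ, hφ, hmem, hfix⟩ := h _ (Set.subset_univ _) hB
    refine ⟨_, hB, ⟨φ, fun a => hmem a trivial, hfix, fun a x => ?_⟩,
      h.mono (Set.subset_univ _), semiConnT_of_isRecurrent ?_⟩
    · rw [← hφ a trivial x, hfix _ (h.isRecurrent_apply a x)]
    · rintro ⟨b, p, hp, hpb⟩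
      exact ⟨p, hp, Subtype.ext ((coe_deltaStar_restrictMap δ _ hB.2 _ p).trans hpb)⟩
  · rintro ⟨B, hB, ⟨φ, hφB, hφfix, hφ⟩, hret, -⟩
    exact hret.of_dilation hB hφB hφfix hφ
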